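/- Let α be a partial action of a groupoid G on a set X. The set (G,X) = {(g,x) : g·x defined}, with product (g,x)(h,y) defined iff d(g)=r(h) and x = h·y, in which case (g,x)(h,y) = (gh,y), is a groupoid; its identities are the pairs (e,x) with e ∈ G_0 and e·x defined, d(g,x) = (d(g),x), and r(g,x) = (r(g), g·x). Moreover the projection Γ: (G,X) → G, (g,x) ↦ g, is a star injective functor. -/

import Mathlib

universe u v

/-- A groupoid in the axiomatic sense: a set with a partial multiplication
(`D g h` means the product `gh` is defined, `mul` is a total function whose
value is only meaningful when the product is defined) and a total inversion. -/
class Gpd (G : Type u) where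
  mul : G → G → G
  inv : G → G
  D : G → G → Prop
  inv_left : ∀ g, D (inv g) g
  inv_right : ∀ g, D g (inv g)
  D_iff : ∀ g h, D g h ↔ mul (inv g) g = mul h (inv h)
  assoc : ∀ g h k, D g h → D h k →
    D (mul g h) k ∧ D g (mul h k) ∧ mul (mul g h) k = mul g (mul h k)
  inv_cancel_left : ∀ g h, D g h → mul (inv g) (mul g h) = h
  inv_cancel_right : ∀ g h, D g h → mul (mul g h) (inv h) = g

namespace Gpd

variable {G : Type u} [Gpd G]

/-- The domain `d(g) = g⁻¹g`. -/
def d (g : G) : G := mul (inv g) g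

/-- The range `r(g) = gg⁻¹`. -/
def r (g : G) : G := mul g (inv g)

/-- Identities (= idempotents) of the groupoid. -/
def IsId (e : G) : Prop := D e e ∧ mul e e = e

/-- The set `G₀` of identities of `G`. -/
def objs (G : Type u) [Gpd G] : Set G := {e | IsId e}

/-- Subgroupoid: a nonempty subset closed under inverses and defined products. -/
def IsSubgroupoid (H : Set G) : Prop :=
  H.Nonempty ∧ (∀ h ∈ H, inv h ∈ H) ∧
    ∀ g h : G, g ∈ H → h ∈ H → D g h → mul g h ∈ H

/-- Wide subgroupoid: a subgroupoid containing all identities of `G`. -/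
def IsWide (H : Set G) : Prop := IsSubgroupoid H ∧ objs G ⊆ H

/-- Normal subgroupoid: wide and closed under defined conjugations `g⁻¹hg`. -/
def IsNormal (H : Set G) : Prop :=
  IsWide H ∧ ∀ g h : G, h ∈ H → D (inv g) h → D (mul (inv g) h) g →
    mul (mul (inv g) h) g ∈ H

end Gpd

open Gpd

/-- A partial action of a groupoid `G` on a set `X` (axioms (PGrA1)-(PGrA3)). -/
structure PAction (G : Type u) (X : Type v) [Gpd G] where
  defined : G → X → Prop
  act : G → X → X
  ex_id : ∀ x : X, ∃ e ∈ objs G, defined e x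
  id_act : ∀ (e : G) (x : X), e ∈ objs G → defined e x → act e x = x
  inv_act : ∀ (g : G) (x : X), defined g x →
    defined (Gpd.inv g) (act g x) ∧ act (Gpd.inv g) (act g x) = x
  comp_act : ∀ (g h : G) (x : X), Gpd.D g h → defined h x → defined g (act h x) →
    defined (Gpd.mul g h) x ∧ act (Gpd.mul g h) x = act g (act h x)

namespace AGAux

variable {G : Type u} {X : Type v} [Gpd G] (P : PAction G X)

abbrev T := {p : G × X // P.defined p.1 p.2}

def DD (p q : T P) : Prop := Gpd.D p.1.1 q.1.1 ∧ p.1.2 = P.act q.1.1 q.1.2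

theorem def_mul (p q : T P) (h : DD P p q) : P.defined (Gpd.mul p.1.1 q.1.1) q.1.2 ∧
    P.act (Gpd.mul p.1.1 q.1.1) q.1.2 = P.act p.1.1 p.1.2 := by
  have h2 := P.comp_act p.1.1 q.1.1 q.1.2 h.1 q.2 (h.2 ▸ p.2)
  exact ⟨h2.1, by rw [h2.2, h.2]⟩

open Classical in
noncomputable def M (p q : T P) : T P :=
  if h : DD P p q then ⟨(Gpd.mul p.1.1 q.1.1, q.1.2), (def_mul P p q h).1⟩ else p

theorem M_val (p q : T P) (h : DD P p q) : (M P p q).1 = (Gpd.mul p.1.1 q.1.1, q.1.2) := by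
  simp [M, h]

def I (p : T P) : T P := ⟨(Gpd.inv p.1.1, P.act p.1.1 p.1.2), (P.inv_act _ _ p.2).1⟩

theorem DI_left (p : T P) : DD P (I P p) p := ⟨Gpd.inv_left _, rfl⟩

theorem DI_right (p : T P) : DD P p (I P p) :=
  ⟨Gpd.inv_right _, (P.inv_act _ _ p.2).2.symm⟩

theorem dom (p : T P) : (M P (I P p) p).1 = (d p.1.1, p.1.2) := M_val P _ _ (DI_left P p)

theorem ran (p : T P) : (M P p (I P p)).1 = (r p.1.1, P.act p.1.1 p.1.2) :=
  M_val P _ _ (DI_right P p)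

theorem ass (p q k : T P) (h1 : DD P p q) (h2 : DD P q k) :
    DD P (M P p q) k ∧ DD P p (M P q k) ∧ M P (M P p q) k = M P p (M P q k) := by
  obtain ⟨a, b, c⟩ := Gpd.assoc _ _ _ h1.1 h2.1
  have A : DD P (M P p q) k := by
    unfold DD; rw [M_val P p q h1]; exact ⟨a, h2.2⟩
  have B : DD P p (M P q k) := by
    unfold DD; rw [M_val P q k h2]; exact ⟨b, by rw [(def_mul P q k h2).2]; exact h1.2⟩
  refine ⟨A, B, Subtype.ext ?_⟩
  rw [M_val P _ _ A, M_val P _ _ B, M_val P _ _ h1, M_val P _ _ h2]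
  simp [c]

noncomputable def S : Gpd (T P) where
  mul := M P
  inv := I P
  D := DD P
  inv_left := DI_left P
  inv_right := DI_right P
  D_iff p q := by
    rw [Subtype.ext_iff, dom, ran, Prod.mk.injEq]
    exact and_congr (Gpd.D_iff _ _) Iff.rfl
  assoc := ass P
  inv_cancel_left p q h := by
    obtain ⟨a, b, c⟩ := ass P _ _ _ (DI_left P p) h
    apply Subtype.ext
    rw [M_val P _ _ b, M_val P _ _ h]
    exact Prod.ext (Gpd.inv_cancel_left _ _ h.1) rfl
  inv_cancel_right p q h := by
    obtain ⟨a, b, c⟩ := ass P _ _ _ h (DI_right P q)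
    apply Subtype.ext
    rw [M_val P _ _ a, M_val P _ _ h]
    exact Prod.ext (Gpd.inv_cancel_right _ _ h.1) h.2.symm

end AGAux

/-- the action groupoid `(G,X)` is a groupoid with the stated
product, domains, ranges and identities, and the projection is star injective. -/
theorem action_groupoid {G : Type u} {X : Type v} [Gpd G] (P : PAction G X) :
    ∃ S : Gpd {p : G × X // P.defined p.1 p.2},
      (∀ p q : {p : G × X // P.defined p.1 p.2},
        S.D p q ↔ d p.1.1 = r q.1.1 ∧ p.1.2 = P.act q.1.1 q.1.2) ∧
      (∀ p q : {p : G × X // P.defined p.1 p.2}, S.D p q →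
        (S.mul p q).1 = (Gpd.mul p.1.1 q.1.1, q.1.2)) ∧
      (∀ p : {p : G × X // P.defined p.1 p.2},
        (S.mul (S.inv p) p).1 = (d p.1.1, p.1.2)) ∧
      (∀ p : {p : G × X // P.defined p.1 p.2},
        (S.mul p (S.inv p)).1 = (r p.1.1, P.act p.1.1 p.1.2)) ∧
      (∀ p : {p : G × X // P.defined p.1 p.2},
        @IsId _ S p ↔ p.1.1 ∈ objs G) ∧
      (∀ p q : {p : G × X // P.defined p.1 p.2}, p.1.1 = q.1.1 →
        S.mul (S.inv p) p = S.mul (S.inv q) q → p = q) := by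
  refine ⟨AGAux.S P, fun p q => and_congr (Gpd.D_iff _ _) Iff.rfl, AGAux.M_val P,
    AGAux.dom P, AGAux.ran P, fun p => ⟨?_, ?_⟩, fun p q h1 h2 => ?_⟩
  · rintro ⟨h1, h2⟩
    have h1 : AGAux.DD P p p := h1
    have h3 := congrArg (fun z => z.1.1) h2
    have h4 := congrArg Prod.fst (AGAux.M_val P p p h1)
    exact ⟨h1.1, h4.symm.trans h3⟩
  · intro h
    have h1 : AGAux.DD P p p := ⟨h.1, (P.id_act _ _ h p.2).symm⟩
    exact ⟨h1, Subtype.ext ((AGAux.M_val P p p h1).trans (Prod.ext h.2 rfl))⟩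
  · have h3 := congrArg Subtype.val h2
    have h4 := (AGAux.dom P p).symm.trans (h3.trans (AGAux.dom P q))
    exact Subtype.ext (Prod.ext h1 (Prod.mk.inj h4).2)
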